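/- arXiv:hep-th/0301039 — 2 statements merged into one kernel-verified Lean document; each statement's English description precedes it below -/
import Mathlib

section
/- Let A and Ā be two smooth Yang–Mills potentials on ℝⁿ, i.e. each satisfies the Yang–Mills equations D_μ F^{μν} = 0 (with its own covariant derivative and field strength), and let f̃ : ℝⁿ → M_N(ℝ) be a smooth matrix-valued function that is covariantly constant with respect to both potentials: ∂_μ f̃ + [A_μ, f̃] = 0 and ∂_μ f̃ + [Ā_μ, f̃] = 0 for all μ. Then the antisymmetric matrix-valued field K^{μν} = Tr(f̃ (F^{μν} − F̄^{μν})) is closed in the bulk, i.e. Σ_μ ∂_μ K^{μν} = 0 identically on ℝⁿ, for every ν. -/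
noncomputable section

/-- Partial derivative of a real-valued function on ℝⁿ in the μ-th coordinate direction. -/
def pdR {n : ℕ} (μ : Fin n) (f : (Fin n → ℝ) → ℝ) : (Fin n → ℝ) → ℝ :=
  fun x => fderiv ℝ f x (Pi.single μ 1)

/-- Entrywise partial derivative of a matrix-valued function on ℝⁿ. -/
def pdM {n N : ℕ} (μ : Fin n) (X : (Fin n → ℝ) → Matrix (Fin N) (Fin N) ℝ) :
    (Fin n → ℝ) → Matrix (Fin N) (Fin N) ℝ :=
  fun x => Matrix.of fun i j => pdR μ (fun y => X y i j) x

/-- Matrix commutator [X, Y] = XY - YX. -/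
def mcomm {N : ℕ} (X Y : Matrix (Fin N) (Fin N) ℝ) : Matrix (Fin N) (Fin N) ℝ :=
  X * Y - Y * X

/-- Covariant derivative D_μ X = ∂_μ X + [A_μ, X]. -/
def covD {n N : ℕ} (A : Fin n → (Fin n → ℝ) → Matrix (Fin N) (Fin N) ℝ)
    (μ : Fin n) (X : (Fin n → ℝ) → Matrix (Fin N) (Fin N) ℝ) :
    (Fin n → ℝ) → Matrix (Fin N) (Fin N) ℝ :=
  fun x => pdM μ X x + mcomm (A μ x) (X x)

/-- Field strength F_{μν} = ∂_μ A_ν − ∂_ν A_μ + [A_μ, A_ν]. -/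
def fieldStr {n N : ℕ} (A : Fin n → (Fin n → ℝ) → Matrix (Fin N) (Fin N) ℝ)
    (μ ν : Fin n) : (Fin n → ℝ) → Matrix (Fin N) (Fin N) ℝ :=
  fun x => pdM μ (A ν) x - pdM ν (A μ) x + mcomm (A μ x) (A ν x)

/-- Field strength with raised indices F^{μν} = η^{μα} η^{νβ} F_{αβ}. -/
def fieldStrUp {n N : ℕ} (ηinv : Fin n → Fin n → ℝ)
    (A : Fin n → (Fin n → ℝ) → Matrix (Fin N) (Fin N) ℝ)
    (μ ν : Fin n) : (Fin n → ℝ) → Matrix (Fin N) (Fin N) ℝ :=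
  fun x => ∑ α, ∑ β, (ηinv μ α * ηinv ν β) • fieldStr A α β x

/-- Smoothness of a matrix-valued function, entrywise. -/
def SmoothM {n N : ℕ} (X : (Fin n → ℝ) → Matrix (Fin N) (Fin N) ℝ) : Prop :=
  ∀ i j, ContDiff ℝ (⊤ : ℕ∞) fun x => X x i j

theorem SmoothM.differentiableAt {n N : ℕ} {X : (Fin n → ℝ) → Matrix (Fin N) (Fin N) ℝ}
    (hX : SmoothM X) (i j : Fin N) (x : Fin n → ℝ) :
    DifferentiableAt ℝ (fun y => X y i j) x :=
  ((hX i j).differentiable (by simp)).differentiableAt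

theorem SmoothM.add {n N : ℕ} {X Y : (Fin n → ℝ) → Matrix (Fin N) (Fin N) ℝ}
    (hX : SmoothM X) (hY : SmoothM Y) : SmoothM fun x => X x + Y x :=
  fun i j => (hX i j).add (hY i j)

theorem SmoothM.sub {n N : ℕ} {X Y : (Fin n → ℝ) → Matrix (Fin N) (Fin N) ℝ}
    (hX : SmoothM X) (hY : SmoothM Y) : SmoothM fun x => X x - Y x :=
  fun i j => (hX i j).sub (hY i j)

theorem SmoothM.mul {n N : ℕ} {X Y : (Fin n → ℝ) → Matrix (Fin N) (Fin N) ℝ}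
    (hX : SmoothM X) (hY : SmoothM Y) : SmoothM fun x => X x * Y x := by
  intro i j
  simp only [Matrix.mul_apply]
  exact ContDiff.sum fun k _ => (hX i k).mul (hY k j)

theorem SmoothM.const_smul {n N : ℕ} {X : (Fin n → ℝ) → Matrix (Fin N) (Fin N) ℝ}
    (c : ℝ) (hX : SmoothM X) : SmoothM fun x => c • X x :=
  fun i j => (hX i j).const_smul c

theorem SmoothM.sum {n N : ℕ} {ι : Type*} {s : Finset ι}
    {X : ι → (Fin n → ℝ) → Matrix (Fin N) (Fin N) ℝ}
    (hX : ∀ k ∈ s, SmoothM (X k)) : SmoothM fun x => ∑ k ∈ s, X k x := by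
  intro i j
  simp only [Matrix.sum_apply]
  exact ContDiff.sum fun k hk => hX k hk i j

theorem SmoothM.pdM {n N : ℕ} {X : (Fin n → ℝ) → Matrix (Fin N) (Fin N) ℝ}
    (μ : Fin n) (hX : SmoothM X) : SmoothM (pdM μ X) :=
  fun i j => ((hX i j).fderiv_right (m := (⊤ : ℕ∞)) (by simp)).clm_apply contDiff_const

theorem SmoothM.fieldStrUp {n N : ℕ} (ηinv : Fin n → Fin n → ℝ)
    {A : Fin n → (Fin n → ℝ) → Matrix (Fin N) (Fin N) ℝ} (hA : ∀ μ, SmoothM (A μ))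
    (μ ν : Fin n) : SmoothM (fieldStrUp ηinv A μ ν) :=
  SmoothM.sum fun α _ => SmoothM.sum fun β _ => SmoothM.const_smul _ <|
    (((hA β).pdM α).sub ((hA α).pdM β)).add
      (((hA α).mul (hA β)).sub ((hA β).mul (hA α)))

theorem SmoothM.differentiableAt_trace {n N : ℕ}
    {X : (Fin n → ℝ) → Matrix (Fin N) (Fin N) ℝ} (hX : SmoothM X) (x : Fin n → ℝ) :
    DifferentiableAt ℝ (fun y => Matrix.trace (X y)) x :=
  DifferentiableAt.fun_sum fun i _ => hX.differentiableAt i i x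

/-- Leibniz rule for the trace of a product of matrix-valued functions. -/
theorem pdR_trace_mul {n N : ℕ} {X Y : (Fin n → ℝ) → Matrix (Fin N) (Fin N) ℝ}
    (hX : SmoothM X) (hY : SmoothM Y) (μ : Fin n) (x : Fin n → ℝ) :
    pdR μ (fun y => Matrix.trace (X y * Y y)) x
      = Matrix.trace (pdM μ X x * Y x + X x * pdM μ Y x) := by
  have h : HasFDerivAt (fun y => Matrix.trace (X y * Y y))
      (∑ i, ∑ j, (X x i j • fderiv ℝ (fun y => Y y j i) x
        + Y x j i • fderiv ℝ (fun y => X y i j) x)) x := by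
    simp only [Matrix.trace, Matrix.diag_apply, Matrix.mul_apply]
    exact HasFDerivAt.fun_sum fun i _ => HasFDerivAt.fun_sum fun j _ =>
      (hX.differentiableAt i j x).hasFDerivAt.mul (hY.differentiableAt j i x).hasFDerivAt
  rw [pdR, h.fderiv]
  simp only [sum_apply, add_apply,
    smul_apply, smul_eq_mul, Matrix.trace, Matrix.diag_apply,
    Matrix.add_apply, Matrix.mul_apply, pdM, pdR, Matrix.of_apply, ← Finset.sum_add_distrib]
  exact Finset.sum_congr rfl fun i _ => Finset.sum_congr rfl fun j _ => by ring

/-- Pairing with a covariantly constant function turns partial derivatives into covariant ones. -/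
theorem pdR_trace_mul_of_covD_eq_zero {n N : ℕ}
    {A : Fin n → (Fin n → ℝ) → Matrix (Fin N) (Fin N) ℝ}
    {f G : (Fin n → ℝ) → Matrix (Fin N) (Fin N) ℝ} (hf : SmoothM f) (hG : SmoothM G)
    {μ : Fin n} {x : Fin n → ℝ} (hcov : covD A μ f x = 0) :
    pdR μ (fun y => Matrix.trace (f y * G y)) x = Matrix.trace (f x * covD A μ G x) := by
  rw [pdR_trace_mul hf hG, eq_neg_of_add_eq_zero_left hcov]
  simp only [covD, mcomm, neg_sub, sub_mul, mul_sub, mul_add, Matrix.trace_add,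
    Matrix.trace_sub, ← mul_assoc]
  rw [mul_assoc (A μ x), Matrix.trace_mul_comm (A μ x)]
  ring

/-- For an on-shell potential `A` and `f` covariantly constant with respect to it,
`Tr(f F^{μν})` is divergence-free. -/
theorem sum_pdR_trace_mul_fieldStrUp_eq_zero {n N : ℕ} {ηinv : Fin n → Fin n → ℝ}
    {A : Fin n → (Fin n → ℝ) → Matrix (Fin N) (Fin N) ℝ} (hA : ∀ μ, SmoothM (A μ))
    {f : (Fin n → ℝ) → Matrix (Fin N) (Fin N) ℝ} (hf : SmoothM f)
    {ν : Fin n} {x : Fin n → ℝ}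
    (hYM : ∑ μ, covD A μ (fieldStrUp ηinv A μ ν) x = 0) (hcov : ∀ μ, covD A μ f x = 0) :
    ∑ μ, pdR μ (fun y => Matrix.trace (f y * fieldStrUp ηinv A μ ν y)) x = 0 := by
  simp_rw [fun μ => pdR_trace_mul_of_covD_eq_zero hf (.fieldStrUp ηinv hA μ ν) (hcov μ)]
  rw [← Matrix.trace_sum, ← Finset.mul_sum, hYM, mul_zero, Matrix.trace_zero]

/-- For two on-shell Yang–Mills potentials `A`, `Abar` and a function `f`
covariantly constant with respect to both, the field
`K^{μν} = Tr(f (F^{μν} − F̄^{μν}))` satisfies `Σ_μ ∂_μ K^{μν} = 0` on ℝⁿ. -/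
theorem yangMills_interpolation_form_closed
    {n N : ℕ} (hn : 1 ≤ n) (hN : 1 ≤ N)
    (η ηinv : Fin n → Fin n → ℝ)
    (hηsymm : ∀ μ ν, η μ ν = η ν μ)
    (hηinv : ∀ μ ν, ∑ ρ, η μ ρ * ηinv ρ ν = if μ = ν then 1 else 0)
    (A Abar : Fin n → (Fin n → ℝ) → Matrix (Fin N) (Fin N) ℝ)
    (hA : ∀ μ, SmoothM (A μ)) (hAbar : ∀ μ, SmoothM (Abar μ))
    (hYM : ∀ ν x, ∑ μ, covD A μ (fieldStrUp ηinv A μ ν) x = 0)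
    (hYMbar : ∀ ν x, ∑ μ, covD Abar μ (fieldStrUp ηinv Abar μ ν) x = 0)
    (f : (Fin n → ℝ) → Matrix (Fin N) (Fin N) ℝ) (hf : SmoothM f)
    (hcov : ∀ μ x, pdM μ f x + mcomm (A μ x) (f x) = 0)
    (hcovbar : ∀ μ x, pdM μ f x + mcomm (Abar μ x) (f x) = 0) :
    ∀ (ν : Fin n) (x : Fin n → ℝ),
      ∑ μ, pdR μ (fun y =>
        Matrix.trace (f y * (fieldStrUp ηinv A μ ν y - fieldStrUp ηinv Abar μ ν y))) x = 0 := by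
  intro ν x
  have hsub (μ : Fin n) : pdR μ (fun y =>
        Matrix.trace (f y * (fieldStrUp ηinv A μ ν y - fieldStrUp ηinv Abar μ ν y))) x
      = pdR μ (fun y => Matrix.trace (f y * fieldStrUp ηinv A μ ν y)) x
        - pdR μ (fun y => Matrix.trace (f y * fieldStrUp ηinv Abar μ ν y)) x := by
    simp only [pdR, mul_sub, Matrix.trace_sub]
    rw [fderiv_fun_sub ((hf.mul (.fieldStrUp ηinv hA μ ν)).differentiableAt_trace x)
      ((hf.mul (.fieldStrUp ηinv hAbar μ ν)).differentiableAt_trace x),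
      sub_apply]
  simp_rw [hsub]
  rw [Finset.sum_sub_distrib,
    sum_pdR_trace_mul_fieldStrUp_eq_zero hA hf (hYM ν x) (hcov · x),
    sum_pdR_trace_mul_fieldStrUp_eq_zero hAbar hf (hYMbar ν x) (hcovbar · x), sub_zero]
end
end

section
/- Let ξ be a smooth vector field on ℝⁿ that is a Killing vector of the flat background, ∂_μ ξ_ν + ∂_ν ξ_μ = 0 for all μ, ν, and let h_{μν} be a smooth symmetric tensor field on ℝⁿ. Then the divergence of the linearized gravity surface form k^{μν} = Σ_{ρ,σ} (ξ_ρ ∂_σ H^{ρσμν}[h; η] + (1/2) H^{ρσμν}[h; η] ∂_ρ ξ_σ) is proportional to the contraction of ξ with the linearized Einstein tensor: Σ_ν ∂_ν k^{μν} = 2 Σ_ρ ξ_ρ G^{ρμ}[h] identically on ℝⁿ. In particular, if h satisfies the linearized Einstein equations G^{μν}[h] = 0, then Σ_ν ∂_ν k^{μν} = 0, i.e. the form is conserved. -/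
noncomputable section

/-- Raised indices: `h^{μν} = η^{μα} η^{νβ} h_{αβ}`. -/
def hUp {n : ℕ} (ηinv : Fin n → Fin n → ℝ) (h : Fin n → Fin n → (Fin n → ℝ) → ℝ)
    (μ ν : Fin n) : (Fin n → ℝ) → ℝ :=
  fun x => ∑ α, ∑ β, ηinv μ α * ηinv ν β * h α β x

/-- The η-trace `h = η^{μν} h_{μν}`. -/
def hTr {n : ℕ} (ηinv : Fin n → Fin n → ℝ) (h : Fin n → Fin n → (Fin n → ℝ) → ℝ) :
    (Fin n → ℝ) → ℝ :=
  fun x => ∑ α, ∑ β, ηinv α β * h α β x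

/-- The trace-reversed field `ĥ^{μν} = h^{μν} − (1/2) η^{μν} h`. -/
def hHat {n : ℕ} (ηinv : Fin n → Fin n → ℝ) (h : Fin n → Fin n → (Fin n → ℝ) → ℝ)
    (μ ν : Fin n) : (Fin n → ℝ) → ℝ :=
  fun x => hUp ηinv h μ ν x - (1 / 2) * ηinv μ ν * hTr ηinv h x

/-- The superpotential tensor
`H^{μανβ}[h; η] = −ĥ^{αβ} η^{μν} − ĥ^{μν} η^{αβ} + ĥ^{αν} η^{μβ} + ĥ^{μβ} η^{αν}`. -/
def Hsup {n : ℕ} (ηinv : Fin n → Fin n → ℝ) (h : Fin n → Fin n → (Fin n → ℝ) → ℝ)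
    (μ α ν β : Fin n) : (Fin n → ℝ) → ℝ :=
  fun x => -hHat ηinv h α β x * ηinv μ ν - hHat ηinv h μ ν x * ηinv α β
    + hHat ηinv h α ν x * ηinv μ β + hHat ηinv h μ β x * ηinv α ν

/-- The linearized Einstein tensor of the flat background:
`G^{μν}[h] = (1/2)(∂^μ ∂_ρ h^{ρν} + ∂^ν ∂_ρ h^{ρμ} − □ h^{μν} − ∂^μ ∂^ν h
− η^{μν} ∂_ρ ∂_σ h^{ρσ} + η^{μν} □ h)`. -/
def linG {n : ℕ} (ηinv : Fin n → Fin n → ℝ) (h : Fin n → Fin n → (Fin n → ℝ) → ℝ)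
    (μ ν : Fin n) : (Fin n → ℝ) → ℝ :=
  fun x => (1 / 2) *
    ((∑ ρ, ∑ σ, ηinv μ ρ * pdR ρ (fun y => pdR σ (hUp ηinv h σ ν) y) x)
      + (∑ ρ, ∑ σ, ηinv ν ρ * pdR ρ (fun y => pdR σ (hUp ηinv h σ μ) y) x)
      - (∑ ρ, ∑ σ, ηinv ρ σ * pdR ρ (fun y => pdR σ (hUp ηinv h μ ν) y) x)
      - (∑ ρ, ∑ σ, ηinv μ ρ * ηinv ν σ * pdR ρ (fun y => pdR σ (hTr ηinv h) y) x)
      - ηinv μ ν * (∑ ρ, ∑ σ, pdR ρ (fun y => pdR σ (hUp ηinv h ρ σ) y) x)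
      + ηinv μ ν * (∑ ρ, ∑ σ, ηinv ρ σ * pdR ρ (fun y => pdR σ (hTr ηinv h) y) x))

/-- The linearized gravity surface form
`k^{μν} = Σ_{ρ,σ} (ξ_ρ ∂_σ H^{ρσμν}[h; η] + (1/2) H^{ρσμν}[h; η] ∂_ρ ξ_σ)`. -/
def kLin {n : ℕ} (ηinv : Fin n → Fin n → ℝ) (h : Fin n → Fin n → (Fin n → ℝ) → ℝ)
    (ξ : Fin n → (Fin n → ℝ) → ℝ) (μ ν : Fin n) : (Fin n → ℝ) → ℝ :=
  fun x => ∑ ρ, ∑ σ,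
    (ξ ρ x * pdR σ (Hsup ηinv h ρ σ μ ν) x
      + (1 / 2) * Hsup ηinv h ρ σ μ ν x * pdR ρ (ξ σ) x)

theorem pdR_add {n : ℕ} (μ : Fin n) {f g : (Fin n → ℝ) → ℝ} {x : Fin n → ℝ}
    (hf : DifferentiableAt ℝ f x) (hg : DifferentiableAt ℝ g x) :
    pdR μ (fun y => f y + g y) x = pdR μ f x + pdR μ g x := by
  simp [pdR, fderiv_fun_add hf hg]

theorem pdR_sum {n : ℕ} {ι : Type*} (s : Finset ι) (μ : Fin n) {f : ι → (Fin n → ℝ) → ℝ}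
    {x : Fin n → ℝ} (hf : ∀ i ∈ s, DifferentiableAt ℝ (f i) x) :
    pdR μ (fun y => ∑ i ∈ s, f i y) x = ∑ i ∈ s, pdR μ (f i) x := by
  simp [pdR, fderiv_fun_sum hf]

theorem pdR_const_mul {n : ℕ} (μ : Fin n) (c : ℝ) {f : (Fin n → ℝ) → ℝ} {x : Fin n → ℝ}
    (hf : DifferentiableAt ℝ f x) : pdR μ (fun y => c * f y) x = c * pdR μ f x := by
  simp [pdR, fderiv_const_mul hf]

theorem pdR_mul {n : ℕ} (μ : Fin n) {f g : (Fin n → ℝ) → ℝ} {x : Fin n → ℝ}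
    (hf : DifferentiableAt ℝ f x) (hg : DifferentiableAt ℝ g x) :
    pdR μ (fun y => f y * g y) x = pdR μ f x * g x + f x * pdR μ g x := by
  simp [pdR, fderiv_fun_mul hf hg]
  ring

theorem ContDiff.pdR {n : ℕ} (μ : Fin n) {f : (Fin n → ℝ) → ℝ}
    (hf : ContDiff ℝ (⊤ : ℕ∞) f) : ContDiff ℝ (⊤ : ℕ∞) (pdR μ f) :=
  (hf.fderiv_right (m := (⊤ : ℕ∞)) le_rfl).clm_apply contDiff_const

theorem ContDiff.differentiableAt_of_top {n : ℕ} {f : (Fin n → ℝ) → ℝ}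
    (hf : ContDiff ℝ (⊤ : ℕ∞) f) (x : Fin n → ℝ) : DifferentiableAt ℝ f x :=
  hf.differentiable (by simp) x

theorem pdR_comm {n : ℕ} (μ ν : Fin n) {f : (Fin n → ℝ) → ℝ}
    (hf : ContDiff ℝ (⊤ : ℕ∞) f) (x : Fin n → ℝ) :
    pdR μ (pdR ν f) x = pdR ν (pdR μ f) x := by
  have hd : DifferentiableAt ℝ (fderiv ℝ f) x :=
    (hf.fderiv_right (m := (⊤ : ℕ∞)) le_rfl).differentiable (by simp) x
  have hpd (a b : Fin n) : pdR a (pdR b f) x =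
      fderiv ℝ (fderiv ℝ f) x (Pi.single a 1) (Pi.single b 1) := by
    unfold pdR
    rw [fderiv_clm_apply hd (differentiableAt_const _)]
    simp
  rw [hpd, hpd]
  refine (hf.contDiffAt.isSymmSndFDerivAt ?_).eq _ _
  rw [minSmoothness_of_isRCLikeNormedField]
  exact WithTop.coe_le_coe.2 (le_top : (2 : ℕ∞) ≤ ⊤)

/-- The second derivatives of a Killing covector field of a flat background vanish. -/
theorem pdR_pdR_killing {n : ℕ} {ξ : Fin n → (Fin n → ℝ) → ℝ}
    (hξ : ∀ μ, ContDiff ℝ (⊤ : ℕ∞) (ξ μ))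
    (hK : ∀ μ ν x, pdR μ (ξ ν) x + pdR ν (ξ μ) x = 0) (a b c : Fin n) (x : Fin n → ℝ) :
    pdR a (pdR b (ξ c)) x = 0 := by
  have key (a b c : Fin n) : pdR a (pdR b (ξ c)) x + pdR a (pdR c (ξ b)) x = 0 := by
    rw [← pdR_add a (((hξ c).pdR b).differentiableAt_of_top x)
      (((hξ b).pdR c).differentiableAt_of_top x)]
    simp only [hK]
    simp [pdR]
  have h1 := key a b c
  have h2 := key b c a
  have h3 := key c a b
  rw [pdR_comm b a (hξ c)] at h2
  rw [pdR_comm c a (hξ b), pdR_comm c b (hξ a)] at h3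
  linarith

theorem inverse_metric_symm {n : ℕ} {η ηinv : Fin n → Fin n → ℝ}
    (hη : ∀ μ ν, η μ ν = η ν μ)
    (hinv : ∀ μ ν, ∑ ρ, η μ ρ * ηinv ρ ν = if μ = ν then 1 else 0) (μ ν : Fin n) :
    ηinv μ ν = ηinv ν μ := by
  have hmul : Matrix.of η * Matrix.of ηinv = 1 := by
    ext a b
    simp [Matrix.mul_apply, Matrix.one_apply, hinv]
  have hT : (Matrix.of η).transpose = Matrix.of η := by
    ext a b
    simp [hη a b]
  have hsym : (Matrix.of ηinv).transpose = Matrix.of ηinv := by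
    rw [← Matrix.inv_eq_right_inv hmul, Matrix.transpose_nonsing_inv, hT]
  exact (congrFun (congrFun hsym ν) μ : _)

section

variable {n : ℕ} {ηinv : Fin n → Fin n → ℝ} {h : Fin n → Fin n → (Fin n → ℝ) → ℝ}

theorem contDiff_hUp (hs : ∀ μ ν, ContDiff ℝ (⊤ : ℕ∞) (h μ ν)) (μ ν : Fin n) :
    ContDiff ℝ (⊤ : ℕ∞) (hUp ηinv h μ ν) :=
  ContDiff.sum fun α _ => ContDiff.sum fun β _ => contDiff_const.mul (hs α β)

theorem contDiff_hTr (hs : ∀ μ ν, ContDiff ℝ (⊤ : ℕ∞) (h μ ν)) :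
    ContDiff ℝ (⊤ : ℕ∞) (hTr ηinv h) :=
  ContDiff.sum fun α _ => ContDiff.sum fun β _ => contDiff_const.mul (hs α β)

theorem contDiff_hHat (hs : ∀ μ ν, ContDiff ℝ (⊤ : ℕ∞) (h μ ν)) (μ ν : Fin n) :
    ContDiff ℝ (⊤ : ℕ∞) (hHat ηinv h μ ν) :=
  (contDiff_hUp hs μ ν).sub (contDiff_const.mul (contDiff_hTr hs))

theorem contDiff_Hsup (hs : ∀ μ ν, ContDiff ℝ (⊤ : ℕ∞) (h μ ν)) (μ α ν β : Fin n) :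
    ContDiff ℝ (⊤ : ℕ∞) (Hsup ηinv h μ α ν β) :=
  (((((contDiff_hHat hs α β).neg).mul contDiff_const).sub
    ((contDiff_hHat hs μ ν).mul contDiff_const)).add
    ((contDiff_hHat hs α ν).mul contDiff_const)).add
    ((contDiff_hHat hs μ β).mul contDiff_const)

theorem hUp_symm (hsymm : ∀ μ ν x, h μ ν x = h ν μ x) (μ ν : Fin n) :
    hUp ηinv h μ ν = hUp ηinv h ν μ := by
  funext x
  unfold hUp
  rw [Finset.sum_comm]
  refine Finset.sum_congr rfl fun α _ => Finset.sum_congr rfl fun β _ => ?_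
  rw [hsymm α β]
  ring

theorem hHat_symm (hη : ∀ μ ν, ηinv μ ν = ηinv ν μ) (hsymm : ∀ μ ν x, h μ ν x = h ν μ x)
    (μ ν : Fin n) : hHat ηinv h μ ν = hHat ηinv h ν μ := by
  funext x
  simp only [hHat, hUp_symm hsymm μ ν, hη μ ν]

theorem pdR_hHat (hs : ∀ μ ν, ContDiff ℝ (⊤ : ℕ∞) (h μ ν)) (τ μ ν : Fin n) :
    pdR τ (hHat ηinv h μ ν) = fun x =>
      pdR τ (hUp ηinv h μ ν) x + -(1 / 2) * ηinv μ ν * pdR τ (hTr ηinv h) x := by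
  funext x
  have hT := (contDiff_hTr (ηinv := ηinv) hs).differentiableAt_of_top x
  rw [← pdR_const_mul τ _ hT,
    ← pdR_add τ ((contDiff_hUp hs μ ν).differentiableAt_of_top x) (hT.const_mul _)]
  congr 1
  funext y
  simp only [hHat]
  ring

theorem pdR_pdR_hHat (hs : ∀ μ ν, ContDiff ℝ (⊤ : ℕ∞) (h μ ν)) (κ τ μ ν : Fin n)
    (x : Fin n → ℝ) :
    pdR κ (pdR τ (hHat ηinv h μ ν)) x = pdR κ (pdR τ (hUp ηinv h μ ν)) x
      + -(1 / 2) * ηinv μ ν * pdR κ (pdR τ (hTr ηinv h)) x := by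
  have hT := ((contDiff_hTr (ηinv := ηinv) hs).pdR τ).differentiableAt_of_top x
  rw [pdR_hHat hs, pdR_add κ (((contDiff_hUp hs μ ν).pdR τ).differentiableAt_of_top x)
    (hT.const_mul _), pdR_const_mul κ _ hT]

theorem pdR_linear_combination {f₁ f₂ f₃ f₄ : (Fin n → ℝ) → ℝ} {x : Fin n → ℝ} (τ : Fin n)
    (c₁ c₂ c₃ c₄ : ℝ) (h₁ : DifferentiableAt ℝ f₁ x) (h₂ : DifferentiableAt ℝ f₂ x)
    (h₃ : DifferentiableAt ℝ f₃ x) (h₄ : DifferentiableAt ℝ f₄ x) :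
    pdR τ (fun y => -f₁ y * c₁ - f₂ y * c₂ + f₃ y * c₃ + f₄ y * c₄) x =
      -pdR τ f₁ x * c₁ - pdR τ f₂ x * c₂ + pdR τ f₃ x * c₃ + pdR τ f₄ x * c₄ := by
  have hd := (((h₁.hasFDerivAt.neg.mul_const c₁).sub (h₂.hasFDerivAt.mul_const c₂)).add
    (h₃.hasFDerivAt.mul_const c₃)).add (h₄.hasFDerivAt.mul_const c₄)
  have he := congrArg (fun L : (Fin n → ℝ) →L[ℝ] ℝ => L (Pi.single τ 1)) hd.fderiv
  refine Eq.trans he ?_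
  simp [pdR]
  ring

theorem pdR_Hsup (hs : ∀ μ ν, ContDiff ℝ (⊤ : ℕ∞) (h μ ν)) (τ μ α ν β : Fin n) :
    pdR τ (Hsup ηinv h μ α ν β) = fun x =>
      -pdR τ (hHat ηinv h α β) x * ηinv μ ν - pdR τ (hHat ηinv h μ ν) x * ηinv α β
        + pdR τ (hHat ηinv h α ν) x * ηinv μ β + pdR τ (hHat ηinv h μ β) x * ηinv α ν := by
  funext x
  have hd (a b : Fin n) := (contDiff_hHat (ηinv := ηinv) hs a b).differentiableAt_of_top x
  exact pdR_linear_combination τ _ _ _ _ (hd _ _) (hd _ _) (hd _ _) (hd _ _)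

theorem pdR_pdR_Hsup (hs : ∀ μ ν, ContDiff ℝ (⊤ : ℕ∞) (h μ ν)) (κ τ μ α ν β : Fin n)
    (x : Fin n → ℝ) :
    pdR κ (pdR τ (Hsup ηinv h μ α ν β)) x =
      -pdR κ (pdR τ (hHat ηinv h α β)) x * ηinv μ ν
        - pdR κ (pdR τ (hHat ηinv h μ ν)) x * ηinv α β
        + pdR κ (pdR τ (hHat ηinv h α ν)) x * ηinv μ β
        + pdR κ (pdR τ (hHat ηinv h μ β)) x * ηinv α ν := by
  have hd (a b : Fin n) := ((contDiff_hHat (ηinv := ηinv) hs a b).pdR τ).differentiableAt_of_top x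
  rw [pdR_Hsup hs]
  exact pdR_linear_combination κ _ _ _ _ (hd _ _) (hd _ _) (hd _ _) (hd _ _)

/-- The linearized Einstein tensor is half the double divergence of the superpotential. -/
theorem sum_pdR_pdR_Hsup (hη : ∀ μ ν, ηinv μ ν = ηinv ν μ)
    (hs : ∀ μ ν, ContDiff ℝ (⊤ : ℕ∞) (h μ ν)) (hsymm : ∀ μ ν x, h μ ν x = h ν μ x)
    (ρ μ : Fin n) (x : Fin n → ℝ) :
    ∑ ν, ∑ σ, pdR ν (pdR σ (Hsup ηinv h ρ σ μ ν)) x = 2 * linG ηinv h ρ μ x := by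
  unfold linG
  rw [Finset.sum_comm (f := fun a b => ηinv μ a * pdR a (fun y => pdR b (hUp ηinv h b ρ) y) x)]
  simp only [Finset.mul_sum, ← Finset.sum_add_distrib, ← Finset.sum_sub_distrib]
  refine Finset.sum_congr rfl fun ν _ => Finset.sum_congr rfl fun σ _ => ?_
  rw [pdR_pdR_Hsup hs]
  simp only [pdR_pdR_hHat hs]
  rw [pdR_comm σ ν (contDiff_hUp hs ν ρ), hUp_symm hsymm σ ν, hUp_symm hsymm ν ρ, hη σ μ, hη σ ν]
  ring

/-- The first-derivative terms of the divergence cancel, by the cyclic identity of `Hsup`. -/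
theorem sum_pdR_Hsup_mul_antisymm (hη : ∀ μ ν, ηinv μ ν = ηinv ν μ)
    (hs : ∀ μ ν, ContDiff ℝ (⊤ : ℕ∞) (h μ ν)) (hsymm : ∀ μ ν x, h μ ν x = h ν μ x)
    {A : Fin n → Fin n → ℝ} (hA : ∀ a b, A a b + A b a = 0) (μ : Fin n) (x : Fin n → ℝ) :
    ∑ ν, ∑ ρ, ∑ σ, (A ν ρ * pdR σ (Hsup ηinv h ρ σ μ ν) x
      + (1 / 2) * pdR ν (Hsup ηinv h ρ σ μ ν) x * A ρ σ) = 0 := by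
  have e₁ : ∑ ν, ∑ ρ, ∑ σ, A ν ρ * pdR σ (Hsup ηinv h ρ σ μ ν) x =
      ∑ c, ∑ a, ∑ b, A a b * pdR c (Hsup ηinv h b c μ a) x := by
    rw [Finset.sum_comm (s := (Finset.univ : Finset (Fin n)))
      (f := fun c a => ∑ b, A a b * pdR c (Hsup ηinv h b c μ a) x)]
    exact Finset.sum_congr rfl fun _ _ => Finset.sum_comm
  have e₂ : ∑ c, ∑ a, ∑ b, A a b * pdR c (Hsup ηinv h b c μ a) x =
      ∑ c, ∑ a, ∑ b, A b a * pdR c (Hsup ηinv h a c μ b) x :=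
    Finset.sum_congr rfl fun _ _ => Finset.sum_comm
  have e₃ : ∑ c, ∑ a, ∑ b, (A a b * pdR c (Hsup ηinv h b c μ a) x
      + A b a * pdR c (Hsup ηinv h a c μ b) x
      + pdR c (Hsup ηinv h a b μ c) x * A a b) = 0 := by
    refine Finset.sum_eq_zero fun c _ => Finset.sum_eq_zero fun a _ =>
      Finset.sum_eq_zero fun b _ => ?_
    rw [eq_neg_of_add_eq_zero_right (hA a b)]
    simp only [pdR_Hsup hs]
    rw [hHat_symm hη hsymm c a, hHat_symm hη hsymm c b, hη c a, hη c b,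
      hHat_symm hη hsymm b a, hη b a]
    ring
  simp only [Finset.sum_add_distrib] at e₃ ⊢
  simp only [mul_assoc (1 / 2 : ℝ), ← Finset.mul_sum _ _ (1 / 2 : ℝ)]
  rw [← e₂] at e₃
  rw [e₁]
  linarith

theorem pdR_kLin (hs : ∀ μ ν, ContDiff ℝ (⊤ : ℕ∞) (h μ ν)) {ξ : Fin n → (Fin n → ℝ) → ℝ}
    (hξ : ∀ μ, ContDiff ℝ (⊤ : ℕ∞) (ξ μ))
    (hK : ∀ μ ν x, pdR μ (ξ ν) x + pdR ν (ξ μ) x = 0) (τ μ ν : Fin n) (x : Fin n → ℝ) :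
    pdR τ (kLin ηinv h ξ μ ν) x = ∑ ρ, ∑ σ,
      (ξ ρ x * pdR τ (pdR σ (Hsup ηinv h ρ σ μ ν)) x
        + (pdR τ (ξ ρ) x * pdR σ (Hsup ηinv h ρ σ μ ν) x
          + (1 / 2) * pdR τ (Hsup ηinv h ρ σ μ ν) x * pdR ρ (ξ σ) x)) := by
  have hH (ρ σ : Fin n) := contDiff_Hsup (ηinv := ηinv) hs ρ σ μ ν
  have d₁ (ρ : Fin n) := (hξ ρ).differentiableAt_of_top x
  have d₂ (ρ σ : Fin n) := ((hH ρ σ).pdR σ).differentiableAt_of_top x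
  have d₃ (ρ σ : Fin n) := ((hH ρ σ).differentiableAt_of_top x).const_mul (1 / 2)
  have d₄ (ρ σ : Fin n) := ((hξ σ).pdR ρ).differentiableAt_of_top x
  have d (ρ σ : Fin n) := ((d₁ ρ).fun_mul (d₂ ρ σ)).fun_add ((d₃ ρ σ).fun_mul (d₄ ρ σ))
  unfold kLin
  rw [pdR_sum _ _ fun ρ _ => DifferentiableAt.fun_sum fun σ _ => d ρ σ]
  refine Finset.sum_congr rfl fun ρ _ => ?_
  rw [pdR_sum _ _ fun σ _ => d ρ σ]
  refine Finset.sum_congr rfl fun σ _ => ?_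
  rw [pdR_add τ ((d₁ ρ).fun_mul (d₂ ρ σ)) ((d₃ ρ σ).fun_mul (d₄ ρ σ)),
    pdR_mul τ (d₁ ρ) (d₂ ρ σ), pdR_mul τ (d₃ ρ σ) (d₄ ρ σ),
    pdR_const_mul τ _ ((hH ρ σ).differentiableAt_of_top x), pdR_pdR_killing hξ hK]
  ring

end

/-- For a Killing vector `ξ` of the flat background and a smooth symmetric
field `h`, `Σ_ν ∂_ν k^{μν} = 2 Σ_ρ ξ_ρ G^{ρμ}[h]` on ℝⁿ; in particular, if `h` solves the
linearized Einstein equations `G^{μν}[h] = 0`, the form `k^{μν}` is conserved. -/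
theorem divergence_kLin_eq_killing_contraction
    {n : ℕ} (hn : 1 ≤ n)
    (η ηinv : Fin n → Fin n → ℝ)
    (hηsymm : ∀ μ ν, η μ ν = η ν μ)
    (hηinv : ∀ μ ν, ∑ ρ, η μ ρ * ηinv ρ ν = if μ = ν then 1 else 0)
    (ξ : Fin n → (Fin n → ℝ) → ℝ)
    (hξsmooth : ∀ μ, ContDiff ℝ (⊤ : ℕ∞) (ξ μ))
    (hKilling : ∀ μ ν x, pdR μ (ξ ν) x + pdR ν (ξ μ) x = 0)
    (h : Fin n → Fin n → (Fin n → ℝ) → ℝ)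
    (hsmooth : ∀ μ ν, ContDiff ℝ (⊤ : ℕ∞) (h μ ν))
    (hsymm : ∀ μ ν x, h μ ν x = h ν μ x) :
    (∀ (μ : Fin n) (x : Fin n → ℝ),
        ∑ ν, pdR ν (kLin ηinv h ξ μ ν) x = 2 * ∑ ρ, ξ ρ x * linG ηinv h ρ μ x) ∧
    ((∀ (μ ν : Fin n) (x : Fin n → ℝ), linG ηinv h μ ν x = 0) →
      ∀ (μ : Fin n) (x : Fin n → ℝ), ∑ ν, pdR ν (kLin ηinv h ξ μ ν) x = 0) := by
  have hη := inverse_metric_symm hηsymm hηinv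
  have main (μ : Fin n) (x : Fin n → ℝ) :
      ∑ ν, pdR ν (kLin ηinv h ξ μ ν) x = 2 * ∑ ρ, ξ ρ x * linG ηinv h ρ μ x := by
    have hcancel := sum_pdR_Hsup_mul_antisymm hη hsmooth hsymm
      (A := fun a b => pdR a (ξ b) x) (fun a b => hKilling a b x) μ x
    simp only [pdR_kLin hsmooth hξsmooth hKilling]
    simp only [Finset.sum_add_distrib (f := fun σ => ξ _ x * _), Finset.sum_add_distrib
      (f := fun ρ => ∑ σ, ξ ρ x * _), Finset.sum_add_distrib (f := fun ν => ∑ ρ, ∑ σ, ξ ρ x * _)]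
    rw [hcancel, add_zero, Finset.sum_comm, Finset.mul_sum]
    refine Finset.sum_congr rfl fun ρ _ => ?_
    rw [mul_left_comm, ← sum_pdR_pdR_Hsup hη hsmooth hsymm]
    simp only [Finset.mul_sum]
  refine ⟨main, fun hG μ x => ?_⟩
  simp [main, hG]
end
end
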